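/- Let k ≥ 2, d ≥ 1, and s ≥ 1 be fixed integers, and fix a k-uniform hypergraph H on vertex set {1,…,s} (i.e., a collection of k-element subsets of {1,…,s}). For every ε > 0 there exists Q > 0 such that for every odd prime power q ≥ Q and every admissible symmetric polynomial f ∈ F_q[x_1,…,x_k] of total degree d, the number of injective maps φ : {1,…,s} → F_q with the property that for every k-element subset S ⊆ {1,…,s}, S is an edge of H if and only if {φ(i) : i ∈ S} is an edge of Y_{f,q}, differs from q^s / 2^{binom(s,k)} by at most ε·q^s. -/

import Mathlib

open MvPolynomial

/-- Substitute: variable `0` of `f` is kept as the polynomial indeterminate `X`, and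
variable `j+1` is replaced by `u j`. -/
noncomputable def substX {F : Type*} [Field F] {k : ℕ} (f : MvPolynomial (Fin k) F)
    (u : Fin (k - 1) → F) : Polynomial F :=
  MvPolynomial.aeval (fun i : Fin k =>
    if h : (i : ℕ) = 0 then (Polynomial.X : Polynomial F)
    else Polynomial.C (u ⟨(i : ℕ) - 1, by have := i.isLt; omega⟩)) f

/-- `f` is admissible: not a constant multiple of a square, and the coefficients of `f` as
a polynomial in `x_1` have no common zero over the algebraic closure. -/
def Admissible {F : Type*} [Field F] {k : ℕ} (f : MvPolynomial (Fin k) F) : Prop :=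
  (¬ ∃ (c : F) (g : MvPolynomial (Fin k) F), f = MvPolynomial.C c * g ^ 2) ∧
  ∀ v : Fin (k - 1) → AlgebraicClosure F,
    substX (MvPolynomial.map (algebraMap F (AlgebraicClosure F)) f) v ≠ 0


section Stepanov

variable {F : Type} [Field F]

lemma st_dvd (g : Polynomial F) (m : ℕ) : ∀ (k : ℕ) (r : Polynomial F),
    g ^ (m - k) ∣ Polynomial.hasseDeriv k (g ^ m * r) := by
  induction m with
  | zero => intro k r; simp
  | succ m ih =>
    intro k r
    rw [pow_succ', mul_assoc, Polynomial.hasseDeriv_mul]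
    apply Finset.dvd_sum
    rintro ⟨i, j⟩ hij
    replace hij : i + j = k := by simpa using hij
    rcases Nat.eq_zero_or_pos i with rfl | hi
    · simp only [Polynomial.hasseDeriv_zero', zero_add] at *
      subst hij
      refine (pow_dvd_pow g (show m + 1 - j ≤ (m - j) + 1 by omega)).trans ?_
      rw [pow_succ']
      exact mul_dvd_mul_left g (ih _ _)
    · exact ((pow_dvd_pow g (show m + 1 - k ≤ m - j by omega)).trans (ih _ _)).mul_left _

lemma st_W (g : Polynomial F) (hg : g ≠ 0) (n k : ℕ) :
    ∃ W : Polynomial F →ₗ[F] Polynomial F, ∀ r,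
      g ^ n * W r = Polynomial.hasseDeriv k (g ^ (n + k) * r) := by
  have h : ∀ r, ∃ w, g ^ n * w = Polynomial.hasseDeriv k (g ^ (n + k) * r) := by
    intro r
    have := st_dvd g (n + k) k r
    rw [Nat.add_sub_cancel] at this
    obtain ⟨w, hw⟩ := this
    exact ⟨w, hw.symm⟩
  choose w hw using h
  have hgn : g ^ n ≠ 0 := pow_ne_zero _ hg
  refine ⟨{ toFun := w, map_add' := ?_, map_smul' := ?_ }, hw⟩
  · intro x y
    apply mul_left_cancel₀ hgn
    rw [hw, mul_add, mul_add, hw, hw, map_add]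
  · intro c x
    apply mul_left_cancel₀ hgn
    rw [hw, mul_smul_comm, map_smul, ← hw]
    simp

lemma st_W_deg (g : Polynomial F) (hg : g ≠ 0) (n k : ℕ) (r w : Polynomial F)
    (h : g ^ n * w = Polynomial.hasseDeriv k (g ^ (n + k) * r)) :
    w.natDegree ≤ k * g.natDegree + r.natDegree := by
  by_cases hw : w = 0
  · simp [hw]
  have h1 := congrArg Polynomial.natDegree h
  rw [Polynomial.natDegree_mul (pow_ne_zero _ hg) hw, Polynomial.natDegree_pow] at h1
  have h2 := Polynomial.natDegree_hasseDeriv_le (g ^ (n + k) * r) k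
  have h3 : (g ^ (n + k) * r).natDegree ≤ (n + k) * g.natDegree + r.natDegree := by
    refine Polynomial.natDegree_mul_le.trans ?_
    rw [Polynomial.natDegree_pow]
  have h4 : (n + k) * g.natDegree = n * g.natDegree + k * g.natDegree := by ring
  omega

lemma st_pig (J l B M : ℕ) (hB : 0 < B) (W W' : ℕ → Polynomial F →ₗ[F] Polynomial F)
    (hW : ∀ k < l, ∀ p : Polynomial F, p.natDegree < B → (W k p).natDegree < M)
    (hW' : ∀ k < l, ∀ p : Polynomial F, p.natDegree < B → (W' k p).natDegree < M)
    (hdim : l * (M + J) < 2 * J * B) :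
    ∃ r s : Fin J → Polynomial F, (∀ j, (r j).natDegree < B) ∧ (∀ j, (s j).natDegree < B) ∧
      (∃ j, r j ≠ 0 ∨ s j ≠ 0) ∧
      ∀ k < l, ∑ j : Fin J, Polynomial.X ^ (j : ℕ) * (W k (r j) + W' k (s j)) = 0 := by
  classical
  let P : (Fin B → F) →ₗ[F] Polynomial F :=
    (Polynomial.degreeLT F B).subtype ∘ₗ (Polynomial.degreeLTEquiv F B).symm.toLinearMap
  have hPinj : ∀ v, P v = 0 → v = 0 := by
    intro v hv
    simpa [P] using hv
  have hPdeg : ∀ v, (P v).natDegree < B := by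
    intro v
    have h1 : P v ∈ Polynomial.degreeLT F B := by simp [P]
    rw [Polynomial.mem_degreeLT] at h1
    by_cases h0 : P v = 0
    · rw [h0]; simpa using hB
    · exact (Polynomial.natDegree_lt_iff_degree_lt h0).2 h1
  let V := Fin J → (Fin B → F) × (Fin B → F)
  let S : ℕ → V →ₗ[F] Polynomial F := fun k =>
    ∑ j : Fin J, (LinearMap.mulLeft F (Polynomial.X ^ (j : ℕ))) ∘ₗ
      ((W k ∘ₗ P ∘ₗ LinearMap.fst F _ _ + W' k ∘ₗ P ∘ₗ LinearMap.snd F _ _) ∘ₗ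
        (LinearMap.proj j : V →ₗ[F] _))
  have hS : ∀ k v, S k v = ∑ j : Fin J, Polynomial.X ^ (j : ℕ) *
      (W k (P (v j).1) + W' k (P (v j).2)) := by
    intro k v
    simp [S]; rfl
  let Φ : V →ₗ[F] (Fin l → Fin (M + J) → F) :=
    LinearMap.pi fun k => LinearMap.pi fun i => Polynomial.lcoeff F i ∘ₗ S k
  have hlt : Module.finrank F (Fin l → Fin (M + J) → F) < Module.finrank F V := by
    simp only [V, Module.finrank_pi_fintype, Module.finrank_prod]
    simp
    nlinarith
  obtain ⟨v, hv, hv0⟩ := (Submodule.ne_bot_iff _).1 (LinearMap.ker_ne_bot_of_finrank_lt (f := Φ) hlt)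
  refine ⟨fun j => P (v j).1, fun j => P (v j).2, fun j => hPdeg _, fun j => hPdeg _, ?_, ?_⟩
  · by_contra hcon
    push Not at hcon
    apply hv0
    funext j
    exact Prod.ext (hPinj _ (hcon j).1) (hPinj _ (hcon j).2)
  · intro k hk
    rw [← hS]
    ext i
    by_cases hi : i < M + J
    · have := congrFun (congrFun (LinearMap.mem_ker.1 hv) ⟨k, hk⟩) ⟨i, hi⟩
      simpa [Φ] using this
    · rw [Polynomial.coeff_zero, hS, Polynomial.finsetSum_coeff]
      apply Finset.sum_eq_zero
      intro j _
      apply Polynomial.coeff_eq_zero_of_natDegree_lt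
      refine lt_of_le_of_lt Polynomial.natDegree_mul_le ?_
      rw [Polynomial.natDegree_X_pow]
      have h1 := Polynomial.natDegree_add_le (W k (P (v j).1)) (W' k (P (v j).2))
      have h2 := hW k hk _ (hPdeg (v j).1)
      have h3 := hW' k hk _ (hPdeg (v j).2)
      have := max_lt h2 h3
      have := j.2
      omega

variable [Fintype F]

lemma st_nonvan (g : Polynomial F) (hg : ¬ ∃ (c : F) (b : Polynomial F), g = Polynomial.C c * b ^ 2)
    (hg0 : g.eval 0 ≠ 0) (hodd : Odd (Fintype.card F)) (B J : ℕ)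
    (hB : 2 * (B - 1) + g.natDegree < Fintype.card F) (r s : Fin J → Polynomial F)
    (hr : ∀ j, (r j).natDegree < B) (hs : ∀ j, (s j).natDegree < B)
    (h : ∑ j : Fin J, (r j + s j * g ^ (Fintype.card F / 2)) *
      Polynomial.X ^ ((j : ℕ) * Fintype.card F) = 0) :
    ∀ j, r j = 0 ∧ s j = 0 := by
  set q := Fintype.card F with hq
  have key : ∀ r s : Polynomial F, r.natDegree < B → s.natDegree < B →
      Polynomial.X ^ q ∣ r + s * g ^ (q / 2) → r = 0 ∧ s = 0 := by
    intro r s hr hs hd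
    have h1 : Polynomial.X ^ q ∣ g ^ q - Polynomial.C (g.eval 0) := by
      rw [Polynomial.X_pow_dvd_iff]
      intro d hd
      rw [← FiniteField.expand_card, Polynomial.coeff_sub, Polynomial.coeff_expand Fintype.card_pos]
      rcases Nat.eq_zero_or_pos d with rfl | hpos
      · simp [Polynomial.coeff_zero_eq_eval_zero]
      · rw [if_neg (Nat.not_dvd_of_pos_of_lt hpos hd), Polynomial.coeff_C, if_neg hpos.ne']
        simp
    have h2 : Polynomial.X ^ q ∣ r ^ 2 * g - s ^ 2 * Polynomial.C (g.eval 0) := by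
      have e : r ^ 2 * g - s ^ 2 * Polynomial.C (g.eval 0) =
          (r + s * g ^ (q / 2)) * ((r - s * g ^ (q / 2)) * g) +
            (g ^ q - Polynomial.C (g.eval 0)) * s ^ 2 := by
        have : g ^ q = g ^ (q / 2) * g ^ (q / 2) * g := by
          rw [← pow_add, ← pow_succ]
          congr 1
          obtain ⟨t, ht⟩ := hodd
          omega
        rw [this]; ring
      rw [e]
      exact dvd_add (hd.mul_right _) (h1.mul_right _)
    have h3 : r ^ 2 * g - s ^ 2 * Polynomial.C (g.eval 0) = 0 := by
      apply Polynomial.eq_zero_of_dvd_of_natDegree_lt h2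
      rw [Polynomial.natDegree_X_pow]
      refine lt_of_le_of_lt (Polynomial.natDegree_sub_le _ _) ?_
      have a1 : (r ^ 2 * g).natDegree ≤ 2 * r.natDegree + g.natDegree :=
        Polynomial.natDegree_mul_le.trans (by rw [Polynomial.natDegree_pow])
      have a2 : (s ^ 2 * Polynomial.C (g.eval 0)).natDegree ≤ 2 * s.natDegree :=
        Polynomial.natDegree_mul_le.trans (by rw [Polynomial.natDegree_pow]; simp)
      apply max_lt <;> omega
    have hgne : g ≠ 0 := by rintro rfl; simp at hg0
    by_cases hs0 : s = 0
    · subst hs0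
      simp [hgne] at h3
      exact ⟨h3, rfl⟩
    · exfalso
      have h4 : r ^ 2 * g = s ^ 2 * Polynomial.C (g.eval 0) := sub_eq_zero.1 h3
      have h5 : r ^ 2 ∣ s ^ 2 := by
        refine ⟨g * Polynomial.C (g.eval 0)⁻¹, ?_⟩
        rw [← mul_assoc, h4, mul_assoc, ← Polynomial.C_mul, mul_inv_cancel₀ hg0]; simp
      have h6 : r ∣ s := by
        classical
        exact (IsIntegrallyClosed.pow_dvd_pow_iff two_ne_zero).1 h5
      obtain ⟨t, rfl⟩ := h6
      have hr0 : r ≠ 0 := left_ne_zero_of_mul hs0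
      apply hg
      refine ⟨g.eval 0, t, ?_⟩
      apply mul_left_cancel₀ (pow_ne_zero 2 hr0)
      rw [h4]; ring
  have main : ∀ n : ℕ, ∀ j : Fin J, (j : ℕ) = n → r j = 0 ∧ s j = 0 := by
    intro n
    induction n using Nat.strong_induction_on with
    | _ n ih =>
      intro j hj
      apply key _ _ (hr j) (hs j)
      have hXn : (Polynomial.X ^ ((j : ℕ) * q) : Polynomial F) ≠ 0 := pow_ne_zero _ Polynomial.X_ne_zero
      rw [← mul_dvd_mul_iff_right hXn, ← pow_add]
      rw [← Finset.add_sum_erase _ _ (Finset.mem_univ j)] at h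
      rw [eq_neg_of_add_eq_zero_left h, dvd_neg]
      apply Finset.dvd_sum
      intro i hi
      have hij : i ≠ j := (Finset.mem_erase.1 hi).1
      rcases lt_or_gt_of_ne (Fin.val_ne_of_ne hij) with hlt | hgt
      · obtain ⟨a1, a2⟩ := ih i (by omega) i rfl
        simp [a1, a2]
      · apply Dvd.dvd.mul_left
        apply pow_dvd_pow
        have : (j + 1 : ℕ) * q ≤ i * q := Nat.mul_le_mul_right _ hgt
        nlinarith
  exact fun j => main j j rfl

end Stepanov


section Stepanov2
variable {F : Type} [Field F] [Fintype F]

lemma st_taylor (α : F) (j : ℕ) :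
    Polynomial.X ^ (Fintype.card F) ∣
      Polynomial.taylor α (Polynomial.X ^ (j * Fintype.card F)) - Polynomial.C (α ^ j) := by
  have h : Polynomial.taylor α (Polynomial.X ^ (j * Fintype.card F)) =
      (Polynomial.X ^ Fintype.card F + Polynomial.C α) ^ j := by
    rw [mul_comm, pow_mul, Polynomial.taylor_pow, Polynomial.taylor_pow, Polynomial.taylor_X,
      ← FiniteField.expand_card]
    simp
  rw [h, Polynomial.C_pow]
  have := sub_dvd_pow_sub_pow (Polynomial.X ^ Fintype.card F + Polynomial.C α) (Polynomial.C α) j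
  simpa using this

lemma st_count (g : Polynomial F)
    (hg : ¬ ∃ (c : F) (b : Polynomial F), g = Polynomial.C c * b ^ 2)
    (hg0 : g.eval 0 ≠ 0) (hodd : Odd (Fintype.card F)) (D B J l : ℕ) (hD : g.natDegree ≤ D)
    (hB : 2 * (B - 1) + D < Fintype.card F) (hB0 : 0 < B) (hl : l ≤ Fintype.card F)
    (hdim : l * ((l * D + B) + J) < 2 * J * B) (a : F) (S : Finset F)
    (hS : ∀ x ∈ S, (g.eval x) ^ (Fintype.card F / 2) = a) :
    l * S.card ≤ l * D + (Fintype.card F / 2) * D + B + (J - 1) * Fintype.card F := by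
  classical
  set q := Fintype.card F with hq
  set c := q / 2 with hc
  have hgne : g ≠ 0 := by rintro rfl; simp at hg0
  choose W hW using fun k => st_W g hgne (l - k) k
  choose W' hW' using fun k => st_W g hgne (l + c - k) k
  have hdegW : ∀ k < l, ∀ p : Polynomial F, p.natDegree < B → (W k p).natDegree < l * D + B := by
    intro k hk p hp
    have h1 := st_W_deg g hgne _ _ _ _ (hW k p)
    have h2 : k * g.natDegree ≤ l * D := Nat.mul_le_mul hk.le hD
    omega
  have hdegW' : ∀ k < l, ∀ p : Polynomial F, p.natDegree < B →
      ((a • W' k) p).natDegree < l * D + B := by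
    intro k hk p hp
    have h1 := st_W_deg g hgne _ _ _ _ (hW' k p)
    have h2 : k * g.natDegree ≤ l * D := Nat.mul_le_mul hk.le hD
    have h3 : ((a • W' k) p).natDegree ≤ (W' k p).natDegree := by
      rw [LinearMap.smul_apply]; exact Polynomial.natDegree_smul_le _ _
    omega
  obtain ⟨r, s, hr, hs, hne, hsum⟩ := st_pig J l B (l * D + B) hB0 W (fun k => a • W' k) hdegW hdegW' hdim
  set h0 := ∑ j : Fin J, (r j + s j * g ^ c) * Polynomial.X ^ ((j : ℕ) * q) with hh0
  have h0ne : h0 ≠ 0 := by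
    intro h0z
    obtain ⟨j, hj⟩ := hne
    obtain ⟨h1, h2⟩ := st_nonvan g hg hg0 hodd B J (by omega) r s hr hs h0z j
    tauto
  set h := g ^ l * h0 with hh
  have hne' : h ≠ 0 := mul_ne_zero (pow_ne_zero _ hgne) h0ne
  have hexp : h = ∑ j : Fin J, (g ^ l * r j + g ^ (l + c) * s j) * Polynomial.X ^ ((j : ℕ) * q) := by
    rw [hh, hh0, Finset.mul_sum]
    refine Finset.sum_congr rfl fun j _ => ?_
    rw [pow_add]; ring
  have hdvd : ∀ α ∈ S, (Polynomial.X - Polynomial.C α) ^ l ∣ h := by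
    intro α hα
    rw [Polynomial.X_sub_C_pow_dvd_iff, ← Polynomial.taylor_apply]
    have e1 : Polynomial.X ^ q ∣ Polynomial.taylor α h -
        ∑ j : Fin J, Polynomial.taylor α (g ^ l * r j + g ^ (l + c) * s j) *
          Polynomial.C (α ^ (j : ℕ)) := by
      rw [hexp, map_sum, ← Finset.sum_sub_distrib]
      apply Finset.dvd_sum
      intro j _
      rw [Polynomial.taylor_mul, ← mul_sub]
      exact (st_taylor α j).mul_left _
    have e2 := (pow_dvd_pow Polynomial.X hl).trans e1
    refine (dvd_iff_dvd_of_dvd_sub e2).2 ?_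
    rw [Polynomial.X_pow_dvd_iff]
    intro k hk
    rw [Polynomial.finsetSum_coeff]
    have e3 := congrArg (Polynomial.eval α) (hsum k hk)
    rw [Polynomial.eval_finsetSum, Polynomial.eval_zero] at e3
    have e4 : ∀ j : Fin J, (Polynomial.taylor α (g ^ l * r j + g ^ (l + c) * s j) *
          Polynomial.C (α ^ (j : ℕ))).coeff k = (g.eval α) ^ (l - k) *
          Polynomial.eval α (Polynomial.X ^ (j : ℕ) * (W k (r j) + (a • W' k) (s j))) := by
      intro j
      have w1 := hW k (r j)
      have w2 := hW' k (s j)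
      rw [Nat.sub_add_cancel hk.le] at w1
      rw [Nat.sub_add_cancel (by omega)] at w2
      rw [Polynomial.coeff_mul_C, Polynomial.taylor_coeff, map_add, ← w1, ← w2,
        show l + c - k = (l - k) + c by omega]
      simp only [Polynomial.eval_add, Polynomial.eval_mul, Polynomial.eval_pow, Polynomial.eval_X,
        LinearMap.smul_apply, Polynomial.eval_smul, smul_eq_mul]
      rw [pow_add, hS α hα]
      ring
    rw [Finset.sum_congr rfl fun j _ => e4 j, ← Finset.mul_sum, e3, mul_zero]
  have hprod : ∏ α ∈ S, (Polynomial.X - Polynomial.C α) ^ l ∣ h := by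
    apply Finset.prod_dvd_of_coprime _ hdvd
    intro x _ y _ hxy
    exact (Polynomial.isCoprime_X_sub_C_of_isUnit_sub (sub_ne_zero.2 hxy).isUnit).pow
  have hdeg := Polynomial.natDegree_le_of_dvd hprod hne'
  rw [Polynomial.natDegree_prod_of_monic _ _ (fun i _ => (Polynomial.monic_X_sub_C i).pow l)] at hdeg
  simp only [Polynomial.natDegree_pow, Polynomial.natDegree_X_sub_C, Finset.sum_const,
    smul_eq_mul, mul_one] at hdeg
  have hdeg0 : h0.natDegree ≤ B + c * D + (J - 1) * q := by
    apply Polynomial.natDegree_sum_le_of_forall_le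
    intro j _
    refine Polynomial.natDegree_mul_le.trans ?_
    rw [Polynomial.natDegree_X_pow]
    have h1 : (s j * g ^ c).natDegree ≤ B + c * D := by
      refine Polynomial.natDegree_mul_le.trans ?_
      rw [Polynomial.natDegree_pow]
      have := hs j
      have := Nat.mul_le_mul_left c hD
      omega
    have h2 := Polynomial.natDegree_add_le (r j) (s j * g ^ c)
    have h3 := max_le (show (r j).natDegree ≤ B + c * D by have := hr j; omega) h1
    have h4 : (j : ℕ) * q ≤ (J - 1) * q := Nat.mul_le_mul_right _ (by have := j.2; omega)
    omega
  have hdegh : h.natDegree ≤ l * D + h0.natDegree := by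
    refine Polynomial.natDegree_mul_le.trans ?_
    rw [Polynomial.natDegree_pow]
    have := Nat.mul_le_mul_left l hD
    omega
  have : l * S.card = S.card * l := mul_comm _ _
  omega

end Stepanov2


section Stepanov3

lemma st_bound (D : ℕ) (ε : ℝ) (hε : 0 < ε) : ∃ Q : ℕ, ∀ (F : Type) [Field F] [Fintype F],
    Odd (Fintype.card F) → Q ≤ Fintype.card F → ∀ g : Polynomial F, g.natDegree ≤ D →
    (¬ ∃ (c : F) (b : Polynomial F), g = Polynomial.C c * b ^ 2) →
    ∀ (a : F) (S : Finset F), (∀ x ∈ S, (g.eval x) ^ (Fintype.card F / 2) = a) →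
    (S.card : ℝ) ≤ (1 / 2 + ε) * Fintype.card F := by
  obtain ⟨n, hn⟩ := exists_nat_ge ((D + 1) / ε)
  obtain ⟨m, hm⟩ := exists_nat_ge (2 * D / ε)
  set l := 2 * n + 1 with hl
  refine ⟨D + 2 * (l * (l * D + n + 1) + 2) + m + l, ?_⟩
  intro F _ _ hodd hQ g hgD hg a S hS
  classical
  set q := Fintype.card F with hq
  have hgne : g ≠ 0 := by rintro rfl; exact hg ⟨0, 0, by simp⟩
  obtain ⟨β, hβ⟩ : ∃ β, g.eval β ≠ 0 := by
    by_contra hcon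
    push Not at hcon
    apply hgne
    exact Polynomial.eq_zero_of_natDegree_lt_card_of_eval_eq_zero g Function.injective_id
      (fun i => hcon i) (by rw [← hq]; omega)
  have key := st_count (Polynomial.taylor β g) ?_ ?_ hodd D ((q - D) / 2) (n + 1) l ?_ ?_ ?_ ?_ ?_ a
    (S.image (fun x => x - β)) ?_
  rotate_left
  · rintro ⟨c, b, hcb⟩
    apply hg
    refine ⟨c, Polynomial.taylor (-β) b, ?_⟩
    have := congrArg (Polynomial.taylor (-β)) hcb
    rw [Polynomial.taylor_taylor] at this
    simpa [Polynomial.taylor_mul, Polynomial.taylor_pow] using this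
  · simpa [Polynomial.taylor_eval] using hβ
  · rw [Polynomial.natDegree_taylor]; exact hgD
  · omega
  · omega
  · omega
  · have : l * (l * D + n + 1) < (q - D) / 2 := by omega
    have e1 : l * (l * D + (q - D) / 2 + (n + 1)) = l * (l * D + n + 1) + l * ((q - D) / 2) := by ring
    have e2 : 2 * (n + 1) * ((q - D) / 2) = l * ((q - D) / 2) + (q - D) / 2 := by rw [hl]; ring
    omega
  · intro x hx
    obtain ⟨y, hy, rfl⟩ := Finset.mem_image.1 hx
    rw [Polynomial.taylor_eval]
    simpa using hS y hy
  rw [Finset.card_image_of_injective _ (sub_left_injective)] at key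
  have k2 : ((l * S.card : ℕ) : ℝ) ≤ _ := Nat.cast_le.2 key
  have hq2 : ((q / 2 : ℕ) : ℝ) ≤ q / 2 := Nat.cast_div_le
  have hB2 : (((q - D) / 2 : ℕ) : ℝ) ≤ q / 2 := by
    refine Nat.cast_div_le.trans ?_
    have : ((q - D : ℕ) : ℝ) ≤ q := by exact_mod_cast Nat.sub_le _ _
    push_cast
    linarith
  have hmq : (m : ℝ) ≤ q := by exact_mod_cast (by omega : m ≤ q)
  push_cast at k2
  rw [div_le_iff₀ hε] at hn hm
  have hlr : (l : ℝ) = 2 * n + 1 := by rw [hl]; push_cast; ring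
  have hq0 : (0 : ℝ) ≤ q := Nat.cast_nonneg _
  have hn0 : (0 : ℝ) ≤ n := Nat.cast_nonneg _
  have hlpos : (0 : ℝ) < l := by rw [hlr]; positivity
  have h1 : ((q / 2 : ℕ) : ℝ) * D ≤ q / 2 * D := mul_le_mul_of_nonneg_right hq2 (Nat.cast_nonneg _)
  have h2 : (l : ℝ) * D ≤ l * (q * ε / 2) := by
    apply mul_le_mul_of_nonneg_left _ hlpos.le
    nlinarith
  have h3 : (D + 1 : ℝ) * q ≤ n * ε * q := mul_le_mul_of_nonneg_right hn hq0
  have h4 : (l : ℝ) * S.card ≤ l * ((1 / 2 + ε) * q) := by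
    have : (0 : ℝ) ≤ ε * q := by positivity
    rw [← hq] at k2
    rw [hlr] at h2 k2 ⊢
    nlinarith
  exact le_of_mul_le_mul_left h4 hlpos

lemma st_weil (D : ℕ) (ε : ℝ) (hε : 0 < ε) : ∃ Q : ℕ, ∀ (F : Type) [Field F] [Fintype F]
    [DecidableEq F],
    Odd (Fintype.card F) → Q ≤ Fintype.card F → ∀ g : Polynomial F, g.natDegree ≤ D →
    (¬ ∃ (c : F) (b : Polynomial F), g = Polynomial.C c * b ^ 2) →
    |∑ x : F, (quadraticChar F (g.eval x) : ℝ)| ≤ ε * Fintype.card F := by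
  obtain ⟨Q, hQ⟩ := st_bound D (ε / 4) (by positivity)
  obtain ⟨m, hm⟩ := exists_nat_ge (2 * D / ε)
  refine ⟨Q + m, ?_⟩
  intro F _ _ _ hodd hq g hgD hg
  have hgne : g ≠ 0 := by rintro rfl; exact hg ⟨0, 0, by simp⟩
  have hchar : ringChar F ≠ 2 := by
    intro h
    have := FiniteField.even_card_iff_char_two.1 h
    rw [Nat.odd_iff] at hodd
    omega
  set q := Fintype.card F with hq'
  set A := Finset.univ.filter fun x : F => quadraticChar F (g.eval x) = 1 with hA
  set B := Finset.univ.filter fun x : F => quadraticChar F (g.eval x) = -1 with hB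
  set Z := Finset.univ.filter fun x : F => g.eval x = 0 with hZ
  have hAc := hQ F hodd (by omega) g hgD hg 1 A (by
    intro x hx
    have hx1 : quadraticChar F (g.eval x) = 1 := (Finset.mem_filter.1 hx).2
    have := quadraticChar_eq_pow_of_char_ne_two' hchar (g.eval x)
    rw [hx1] at this
    simpa using this.symm)
  have hBc := hQ F hodd (by omega) g hgD hg (-1) B (by
    intro x hx
    have hx1 : quadraticChar F (g.eval x) = -1 := (Finset.mem_filter.1 hx).2
    have := quadraticChar_eq_pow_of_char_ne_two' hchar (g.eval x)
    rw [hx1] at this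
    simpa using this.symm)
  have hZc : Z.card ≤ D := by
    refine le_trans ?_ hgD
    refine le_trans ?_ (Polynomial.card_roots' g)
    refine le_trans ?_ (Multiset.toFinset_card_le _)
    apply Finset.card_le_card
    intro x hx
    simp only [Multiset.mem_toFinset, Polynomial.mem_roots hgne]
    exact (Finset.mem_filter.1 hx).2
  have hpt : ∀ x : F, (quadraticChar F (g.eval x) : ℝ) =
      (if quadraticChar F (g.eval x) = 1 then 1 else 0) -
      (if quadraticChar F (g.eval x) = -1 then 1 else 0) ∧
      (1 : ℝ) = (if quadraticChar F (g.eval x) = 1 then 1 else 0) +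
      (if quadraticChar F (g.eval x) = -1 then 1 else 0) + (if g.eval x = 0 then 1 else 0) := by
    intro x
    by_cases hx : g.eval x = 0
    · simp [hx]
    · rcases quadraticChar_dichotomy hx with h | h <;> simp [h, hx]
  have hsum : ∑ x : F, (quadraticChar F (g.eval x) : ℝ) = A.card - B.card := by
    rw [Finset.sum_congr rfl fun x _ => (hpt x).1, Finset.sum_sub_distrib]
    simp [hA, hB]
  have htot : (q : ℝ) = A.card + B.card + Z.card := by
    have : (q : ℝ) = ∑ x : F, (1 : ℝ) := by simp [hq']
    rw [this, Finset.sum_congr rfl fun x _ => (hpt x).2, Finset.sum_add_distrib,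
      Finset.sum_add_distrib]
    simp [hA, hB, hZ]
  have hZr : (Z.card : ℝ) ≤ D := by exact_mod_cast hZc
  have hmq : (m : ℝ) ≤ q := by exact_mod_cast (by omega : m ≤ q)
  rw [div_le_iff₀ hε] at hm
  have : (m : ℝ) * ε ≤ q * ε := mul_le_mul_of_nonneg_right hmq hε.le
  rw [hsum, abs_le]
  constructor <;> nlinarith

end Stepanov3


section SqrtApprox

def CB {F : Type} [Field F] {n : ℕ} (K : ℕ) (p : Polynomial (MvPolynomial (Fin n) F)) : Prop :=
  ∀ j, (p.coeff j).totalDegree ≤ K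

variable {F : Type} [Field F] {n : ℕ}

lemma CB.mul {K L : ℕ} {p r : Polynomial (MvPolynomial (Fin n) F)} (hp : CB K p) (hr : CB L r) :
    CB (K + L) (p * r) := by
  intro j
  rw [Polynomial.coeff_mul]
  apply MvPolynomial.totalDegree_finsetSum_le
  intro i _
  exact (MvPolynomial.totalDegree_mul _ _).trans (Nat.add_le_add (hp _) (hr _))

lemma CB.add {K L : ℕ} {p r : Polynomial (MvPolynomial (Fin n) F)} (hp : CB K p) (hr : CB L r) :
    CB (K + L) (p + r) := by
  intro j
  rw [Polynomial.coeff_add]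
  refine (MvPolynomial.totalDegree_add _ _).trans (max_le ((hp j).trans ?_) ((hr j).trans ?_)) <;> omega

lemma CB.sub {K L : ℕ} {p r : Polynomial (MvPolynomial (Fin n) F)} (hp : CB K p) (hr : CB L r) :
    CB (K + L) (p - r) := by
  intro j
  rw [Polynomial.coeff_sub]
  refine (MvPolynomial.totalDegree_sub _ _).trans (max_le ((hp j).trans ?_) ((hr j).trans ?_)) <;> omega

lemma CB.C {K : ℕ} {a : MvPolynomial (Fin n) F} (ha : a.totalDegree ≤ K) :
    CB K (Polynomial.C a) := by
  intro j
  rw [Polynomial.coeff_C]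
  split_ifs
  · exact ha
  · simp

lemma CB.X (m : ℕ) : CB 0 (Polynomial.X ^ m : Polynomial (MvPolynomial (Fin n) F)) := by
  intro j
  rw [Polynomial.coeff_X_pow]
  split_ifs <;> simp

lemma td_pow {a : MvPolynomial (Fin n) F} {K : ℕ} (ha : a.totalDegree ≤ K) (N : ℕ) :
    (a ^ N).totalDegree ≤ N * K :=
  (MvPolynomial.totalDegree_pow _ _).trans (Nat.mul_le_mul_left _ ha)

lemma sq_approx (D m : ℕ) : ∀ i ≤ m, ∃ N K : ℕ, ∀ (F : Type) [Field F] (n : ℕ), (2 : F) ≠ 0 →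
    ∀ p : Polynomial (MvPolynomial (Fin n) F), p.natDegree ≤ 2 * m → CB D p →
    ∃ B : Polynomial (MvPolynomial (Fin n) F), B.natDegree ≤ m ∧
      B.coeff m = (p.coeff (2 * m)) ^ (N + 1) ∧ CB K B ∧
      ∀ j, 2 * m - i ≤ j → (Polynomial.C (p.coeff (2 * m) ^ (2 * N + 1)) * p - B ^ 2).coeff j = 0 := by
  intro i
  induction i with
  | zero =>
    intro _
    refine ⟨0, D, ?_⟩
    intro F _ n h2 p hp hD
    refine ⟨Polynomial.C (p.coeff (2 * m)) * Polynomial.X ^ m, ?_, ?_, ?_, ?_⟩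
    · exact Polynomial.natDegree_C_mul_X_pow_le _ _
    · simp
    · exact (CB.C (hD _)).mul (CB.X m)
    · intro j hj
      rw [mul_pow, ← pow_mul, ← Polynomial.C_pow, Polynomial.coeff_sub, Polynomial.coeff_C_mul,
        Polynomial.coeff_C_mul_X_pow]
      split_ifs with h
      · rw [h, mul_comm m 2]; ring
      · rw [Polynomial.coeff_eq_zero_of_natDegree_lt (show p.natDegree < j by omega)]; simp
  | succ i ih =>
    intro hi
    obtain ⟨N, K, hNK⟩ := ih (by omega)
    refine ⟨2 * N + 1, ((N + 1) * D + K) + (0 + ((2 * N + 1) * D + D + (K + K)) + 0), ?_⟩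
    intro F _ n h2 p hp hD
    obtain ⟨B, hB1, hB2, hB3, hB4⟩ := hNK F n h2 p hp hD
    set c := p.coeff (2 * m) with hc
    set E := Polynomial.C (c ^ (2 * N + 1)) * p - B ^ 2 with hE
    have hEb : CB ((2 * N + 1) * D + D + (K + K)) E := by
      rw [hE, pow_two]
      exact ((CB.C (td_pow (hD _) _)).mul hD).sub (hB3.mul hB3)
    set e : MvPolynomial (Fin n) F := MvPolynomial.C (2⁻¹ : F) * E.coeff (2 * m - i - 1) with he
    have he2 : 2 * e = E.coeff (2 * m - i - 1) := by
      have : (2 : MvPolynomial (Fin n) F) = MvPolynomial.C 2 := (map_ofNat MvPolynomial.C 2).symm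
      rw [he, ← mul_assoc, this, ← MvPolynomial.C_mul, mul_inv_cancel₀ h2]; simp
    refine ⟨Polynomial.C (c ^ (N + 1)) * B + Polynomial.C e * Polynomial.X ^ (m - i - 1), ?_, ?_, ?_, ?_⟩
    · refine Polynomial.natDegree_add_le_of_degree_le
        ((Polynomial.natDegree_C_mul_le _ _).trans hB1)
        ((Polynomial.natDegree_C_mul_X_pow_le _ _).trans (by omega))
    · rw [Polynomial.coeff_add, Polynomial.coeff_C_mul, hB2, Polynomial.coeff_C_mul_X_pow,
        if_neg (by omega)]
      ring
    · refine ((CB.C (td_pow (hD _) _)).mul hB3).add ((CB.C ?_).mul (CB.X _))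
      refine (MvPolynomial.totalDegree_mul _ _).trans (Nat.add_le_add (by simp) (hEb _))
    · intro j hj
      have key : Polynomial.C (c ^ (2 * (2 * N + 1) + 1)) * p -
          (Polynomial.C (c ^ (N + 1)) * B + Polynomial.C e * Polynomial.X ^ (m - i - 1)) ^ 2 =
          Polynomial.C (c ^ (2 * N + 2)) * E
            - Polynomial.C (c ^ (N + 1) * (2 * e)) * (B * Polynomial.X ^ (m - i - 1))
            - Polynomial.C (e ^ 2) * Polynomial.X ^ ((m - i - 1) * 2) := by
        rw [hE, pow_mul Polynomial.X]
        simp only [Polynomial.C_pow, Polynomial.C_mul]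
        rw [show Polynomial.C (2 : MvPolynomial (Fin n) F) = 2 from map_ofNat Polynomial.C 2]
        ring
      rw [key]
      simp only [Polynomial.coeff_sub, Polynomial.coeff_C_mul, Polynomial.coeff_X_pow]
      rw [if_neg (show ¬ j = (m - i - 1) * 2 by omega)]
      obtain ⟨t, rfl⟩ : ∃ t, j = t + (m - i - 1) := ⟨j - (m - i - 1), by omega⟩
      rw [Polynomial.coeff_mul_X_pow]
      rcases Nat.lt_or_ge m t with ht | ht
      · rw [hB4 _ (by omega), Polynomial.coeff_eq_zero_of_natDegree_lt (by omega : B.natDegree < t)]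
        simp
      · have : t = m := by omega
        subst this
        rw [hB2, he2, show t + (t - i - 1) = 2 * t - i - 1 by omega]
        ring

lemma not_sq_special (m : ℕ) (h2 : (2 : F) ≠ 0) (g B E : Polynomial F) (a t : F) (ht : t ≠ 0)
    (hg : g.natDegree = 2 * m) (hB : B.natDegree ≤ m) (hBm : B.coeff m = t)
    (hgt : (Polynomial.C a * g).coeff (2 * m) = t ^ 2)
    (hE : Polynomial.C a * g - B ^ 2 = E) (hE0 : E ≠ 0) (hEd : ∀ j, m ≤ j → E.coeff j = 0) :
    ¬ ∃ (c : F) (b : Polynomial F), g = Polynomial.C c * b ^ 2 := by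
  rintro ⟨c, b, rfl⟩
  rw [← mul_assoc, ← Polynomial.C_mul] at hgt hE
  have hc : c ≠ 0 := by
    rintro rfl
    apply ht
    simpa using hgt.symm
  have hbd : b.natDegree = m := by
    rw [Polynomial.natDegree_C_mul hc, Polynomial.natDegree_pow] at hg
    omega
  have hbl : (b ^ 2).coeff (2 * m) = b.coeff m ^ 2 := by
    exact Polynomial.coeff_pow_of_natDegree_le hbd.le
  rw [Polynomial.coeff_C_mul, hbl] at hgt
  set β := b.coeff m with hβ
  have hβ0 : β ≠ 0 := by
    rintro h0
    rw [h0] at hgt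
    apply ht
    simpa using hgt.symm
  set b1 := Polynomial.C (t / β) * b with hb1
  have e1 : b1 ^ 2 = Polynomial.C (a * c) * b ^ 2 := by
    rw [hb1, mul_pow, ← Polynomial.C_pow]
    congr 2
    rw [div_pow, ← hgt]
    field_simp
  rw [← e1] at hE
  have e2 : (b1 - B) * (b1 + B) = E := by rw [← hE]; ring
  have hb1m : (b1 + B).coeff m = 2 * t := by
    rw [Polynomial.coeff_add, hBm, hb1, Polynomial.coeff_C_mul, ← hβ, div_mul_cancel₀ _ hβ0]
    ring
  have h3 : m ≤ (b1 + B).natDegree := Polynomial.le_natDegree_of_ne_zero (by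
    rw [hb1m]; exact mul_ne_zero h2 ht)
  have h4 : E.natDegree = (b1 - B).natDegree + (b1 + B).natDegree := by
    rw [← e2]
    rw [← e2] at hE0
    exact Polynomial.natDegree_mul (left_ne_zero_of_mul hE0) (right_ne_zero_of_mul hE0)
  have := hEd E.natDegree (by omega)
  exact hE0 (Polynomial.leadingCoeff_eq_zero.1 this)

lemma generic_nonsq (D : ℕ) : ∃ K : ℕ, ∀ (F : Type) [Field F] (n : ℕ), (2 : F) ≠ 0 →
    ∀ p : Polynomial (MvPolynomial (Fin n) F), p.natDegree ≤ D → CB D p →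
    (∀ c : MvPolynomial (Fin n) F, c ≠ 0 → ∀ B : Polynomial (MvPolynomial (Fin n) F),
      Polynomial.C c * p ≠ B ^ 2) →
    ∃ A : MvPolynomial (Fin n) F, A ≠ 0 ∧ A.totalDegree ≤ K ∧
      ∀ x, MvPolynomial.eval x A ≠ 0 →
        ¬ ∃ (c : F) (b : Polynomial F), p.map (MvPolynomial.eval x) = Polynomial.C c * b ^ 2 := by
  choose N K hNK using fun m => sq_approx D m m le_rfl
  refine ⟨D + ∑ m ∈ Finset.range (D + 1), (D + ((2 * N m + 1) * D + D + (K m + K m))), ?_⟩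
  intro F _ n h2 p hpD hp hns
  have hp0 : p ≠ 0 := by
    rintro rfl
    exact hns 1 one_ne_zero 0 (by simp)
  rcases Nat.even_or_odd' p.natDegree with ⟨m, hm | hm⟩
  · obtain ⟨B, hB1, hB2, hB3, hB4⟩ := hNK m F n h2 p hm.le hp
    set c := p.coeff (2 * m) with hc
    have hc0 : c ≠ 0 := by
      rw [hc, ← hm]; exact Polynomial.leadingCoeff_ne_zero.2 hp0
    set E := Polynomial.C (c ^ (2 * N m + 1)) * p - B ^ 2 with hE
    have hE0 : E ≠ 0 := fun h => hns _ (pow_ne_zero _ hc0) B (sub_eq_zero.1 h)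
    have hEb : CB ((2 * N m + 1) * D + D + (K m + K m)) E := by
      rw [hE, pow_two]
      exact ((CB.C (td_pow (hp _) _)).mul hp).sub (hB3.mul hB3)
    have hl : E.leadingCoeff ≠ 0 := Polynomial.leadingCoeff_ne_zero.2 hE0
    refine ⟨c * E.leadingCoeff, mul_ne_zero hc0 hl, ?_, ?_⟩
    · have h1 := MvPolynomial.totalDegree_mul c E.leadingCoeff
      have h3 : c.totalDegree ≤ D := hp (2 * m)
      have h4 := hEb E.natDegree
      have h5 := Finset.single_le_sum (f := fun m => (D + ((2 * N m + 1) * D + D + (K m + K m))))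
        (fun _ _ => Nat.zero_le _) (show m ∈ Finset.range (D + 1) by
          rw [Finset.mem_range]; omega)
      simp only [Polynomial.leadingCoeff] at *
      omega
    · intro x hx
      rw [map_mul] at hx
      have hx1 := left_ne_zero_of_mul hx
      have hx2 := right_ne_zero_of_mul hx
      refine not_sq_special m h2 (p.map (MvPolynomial.eval x)) (B.map (MvPolynomial.eval x))
        (E.map (MvPolynomial.eval x)) ((MvPolynomial.eval x c) ^ (2 * N m + 1))
        ((MvPolynomial.eval x c) ^ (N m + 1)) (pow_ne_zero _ hx1) ?_ ?_ ?_ ?_ ?_ ?_ ?_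
      · rw [Polynomial.natDegree_map_of_leadingCoeff_ne_zero, hm]
        rw [Polynomial.leadingCoeff, hm]; exact hx1
      · exact Polynomial.natDegree_map_le.trans hB1
      · rw [Polynomial.coeff_map, hB2, map_pow]
      · rw [Polynomial.coeff_C_mul, Polynomial.coeff_map, ← hc]; ring
      · rw [hE]; simp
      · intro h
        have := congrArg (fun P => Polynomial.coeff P E.natDegree) h
        simp only [Polynomial.coeff_map, Polynomial.coeff_zero] at this
        exact hx2 this
      · intro j hj
        rw [Polynomial.coeff_map, hB4 j (by omega), map_zero]
  · refine ⟨p.leadingCoeff, Polynomial.leadingCoeff_ne_zero.2 hp0, (hp _).trans (by omega), ?_⟩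
    rintro x hx ⟨c, b, hcb⟩
    have h1 := Polynomial.natDegree_map_of_leadingCoeff_ne_zero (MvPolynomial.eval x) hx
    rw [hcb] at h1
    by_cases hc : c = 0
    · subst hc; simp at h1; omega
    · rw [Polynomial.natDegree_C_mul hc, Polynomial.natDegree_pow] at h1
      omega

end SqrtApprox


section MvSum

lemma sz_bound {F : Type} [Field F] [Fintype F] [DecidableEq F] {n K : ℕ}
    (A : MvPolynomial (Fin n) F) (hA : A ≠ 0) (hK : A.totalDegree ≤ K) :
    ((Finset.univ.filter fun x : Fin n → F => MvPolynomial.eval x A = 0).card : ℝ) *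
      Fintype.card F ≤ K * (Fintype.card F : ℝ) ^ n := by
  have h := MvPolynomial.schwartz_zippel_totalDegree hA (Finset.univ : Finset F)
  have hq : (0 : ℝ) < Fintype.card F := by exact_mod_cast Fintype.card_pos
  have h' : ((Finset.univ.filter fun x : Fin n → F => MvPolynomial.eval x A = 0).card : ℝ) /
      (Fintype.card F : ℝ) ^ n ≤ A.totalDegree / (Fintype.card F : ℝ) := by
    rw [Fintype.piFinset_univ] at h
    have := (Rat.cast_le (K := ℝ)).2 (show _ ≤ (_ : ℚ) by exact_mod_cast h)
    simpa using this
  rw [div_le_div_iff₀ (by positivity) hq] at h'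
  refine h'.trans ?_
  have : (A.totalDegree : ℝ) ≤ K := by exact_mod_cast hK
  gcongr

lemma abs_qc {F : Type} [Field F] [Fintype F] [DecidableEq F] (a : F) :
    |(quadraticChar F a : ℝ)| ≤ 1 := by
  by_cases h : a = 0
  · simp [h]
  · rcases quadraticChar_dichotomy h with h | h <;> simp [h]

lemma mv_sum0 (n D : ℕ) (ε : ℝ) (hε : 0 < ε) : ∃ Q : ℕ, ∀ (F : Type) [Field F] [Fintype F]
    [DecidableEq F],
    Odd (Fintype.card F) → Q ≤ Fintype.card F → ∀ G : MvPolynomial (Fin (n + 1)) F,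
    G.totalDegree ≤ D →
    (∀ c : MvPolynomial (Fin n) F, c ≠ 0 → ∀ B, rename Fin.succ c * G ≠ B ^ 2) →
    |∑ φ : Fin (n + 1) → F, (quadraticChar F (eval φ G) : ℝ)| ≤ ε * (Fintype.card F : ℝ) ^ (n + 1) := by
  obtain ⟨K, hK⟩ := generic_nonsq D
  obtain ⟨Q, hQ⟩ := st_weil D (ε / 2) (by positivity)
  obtain ⟨m, hm⟩ := exists_nat_ge (2 * K / ε)
  refine ⟨Q + m, ?_⟩
  intro F _ _ _ hodd hq G hGD hG
  have h2 : (2 : F) ≠ 0 := by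
    apply Ring.two_ne_zero
    intro h
    have := FiniteField.even_card_iff_char_two.1 h
    rw [Nat.odd_iff] at hodd
    omega
  set q := Fintype.card F with hq'
  set p := finSuccEquiv F n G with hp
  have hpd : p.natDegree ≤ D := by
    rw [hp, natDegree_finSuccEquiv]
    exact (degreeOf_le_totalDegree _ _).trans hGD
  have hpb : CB D p := by
    intro j
    by_cases h0 : p.coeff j = 0
    · simp [h0]
    · have := totalDegree_coeff_finSuccEquiv_add_le G j h0
      rw [← hp] at this
      omega
  have hren : ∀ c : MvPolynomial (Fin n) F, finSuccEquiv F n (rename Fin.succ c) = Polynomial.C c := by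
    intro c
    induction c using MvPolynomial.induction_on with
    | C a => simp [finSuccEquiv_apply]
    | add p q hp hq => simp only [map_add, hp, hq]
    | mul_X p i hp => simp only [map_mul, hp, rename_X, finSuccEquiv_X_succ]
  obtain ⟨A, hA0, hAK, hA⟩ := hK F n h2 p hpd hpb (by
    intro c hc B hB
    apply hG c hc ((finSuccEquiv F n).symm B)
    apply (finSuccEquiv F n).injective
    rw [map_mul, map_pow, hren, AlgEquiv.apply_symm_apply]
    exact hB)
  have hsum : ∑ φ : Fin (n + 1) → F, (quadraticChar F (eval φ G) : ℝ) =
      ∑ x : Fin n → F, ∑ y : F, (quadraticChar F ((p.map (eval x)).eval y) : ℝ) := by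
    rw [← Fintype.sum_equiv (Fin.consEquiv (fun _ => F)) (fun z => (quadraticChar F
      (eval (Fin.cons z.1 z.2) G) : ℝ)) _ (fun z => rfl), Fintype.sum_prod_type_right]
    refine Finset.sum_congr rfl fun x _ => Finset.sum_congr rfl fun y _ => ?_
    rw [eval_eq_eval_mv_eval']
  rw [hsum]
  refine (Finset.abs_sum_le_sum_abs _ _).trans ?_
  have hpt : ∀ x : Fin n → F, |∑ y : F, (quadraticChar F ((p.map (eval x)).eval y) : ℝ)| ≤
      ε / 2 * q + (if eval x A = 0 then (q : ℝ) else 0) := by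
    intro x
    split_ifs with h
    · refine (Finset.abs_sum_le_sum_abs _ _).trans ?_
      refine (Finset.sum_le_card_nsmul _ _ 1 (fun y _ => abs_qc _)).trans ?_
      simp only [Finset.card_univ, nsmul_eq_mul, mul_one, ← hq']
      have : 0 ≤ ε / 2 * (q : ℝ) := by positivity
      linarith
    · rw [add_zero]
      exact hQ F hodd (by omega) _ (Polynomial.natDegree_map_le.trans hpd) (hA x h)
  refine (Finset.sum_le_sum fun x _ => hpt x).trans ?_
  rw [Finset.sum_add_distrib, ← Finset.sum_filter, Finset.sum_const, Finset.sum_const]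
  simp only [Finset.card_univ, Fintype.card_fun, Fintype.card_fin, nsmul_eq_mul, ← hq']
  have h3 := sz_bound A hA0 hAK
  rw [← hq'] at h3
  rw [div_le_iff₀ hε] at hm
  have hmq : (m : ℝ) ≤ q := by exact_mod_cast (by omega : m ≤ q)
  have h4 : (K : ℝ) ≤ ε / 2 * q := by nlinarith
  have h5 : (K : ℝ) * (q : ℝ) ^ n ≤ ε / 2 * q * q ^ n := by gcongr
  push_cast
  rw [pow_succ]
  linarith

lemma mv_sum (s D : ℕ) (ε : ℝ) (hε : 0 < ε) : ∃ Q : ℕ, ∀ (F : Type) [Field F] [Fintype F]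
    [DecidableEq F],
    Odd (Fintype.card F) → Q ≤ Fintype.card F → ∀ G : MvPolynomial (Fin s) F,
    G.totalDegree ≤ D → ∀ v : Fin s,
    (∀ c : MvPolynomial (Fin s) F, c ≠ 0 → v ∉ c.vars → ∀ B, c * G ≠ B ^ 2) →
    |∑ φ : Fin s → F, (quadraticChar F (eval φ G) : ℝ)| ≤ ε * (Fintype.card F : ℝ) ^ s := by
  rcases s with _ | n
  · exact ⟨0, fun F _ _ _ _ _ G _ v => v.elim0⟩
  obtain ⟨Q, hQ⟩ := mv_sum0 n D ε hε
  refine ⟨Q, ?_⟩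
  intro F _ _ _ hodd hq G hGD v hG
  have key := hQ F hodd hq (rename (Equiv.swap 0 v) G) ((totalDegree_rename_le _ _).trans hGD) ?_
  · convert key using 2
    apply Fintype.sum_equiv (Equiv.arrowCongr (Equiv.swap 0 v) (Equiv.refl F))
    intro φ
    rw [eval_rename]
    congr 4
    funext i
    simp
  · intro c hc B hB
    refine hG (rename (Equiv.swap 0 v) (rename Fin.succ c)) ?_ ?_ (rename (Equiv.swap 0 v) B) ?_
    · rw [rename_rename]
      intro h
      apply hc
      apply rename_injective _ ((Equiv.injective _).comp (Fin.succ_injective _))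
      rw [h, map_zero]
    · rw [rename_rename]
      intro h
      obtain ⟨i, _, hi⟩ := mem_vars_rename _ _ h
      have : Fin.succ i = 0 := by
        apply (Equiv.swap 0 v).injective
        simpa using hi
      exact Fin.succ_ne_zero _ this
    · have := congrArg (rename (Equiv.swap 0 v)) hB
      rw [map_mul, map_pow, rename_rename (Equiv.swap 0 v) (Equiv.swap 0 v) G] at this
      rw [← this]
      congr 1
      have e : (⇑(Equiv.swap 0 v) ∘ ⇑(Equiv.swap 0 v)) = id := by funext i; simp
      rw [e, rename_id_apply]

end MvSum


section Alg

lemma sqfree_decomp {R : Type*} [CommRing R] [IsDomain R] [UniqueFactorizationMonoid R] (f : R) :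
    f ≠ 0 → ∃ a b : R, f = a * b ^ 2 ∧ Squarefree a := by
  induction f using UniqueFactorizationMonoid.induction_on_prime with
  | h₁ => intro h; exact absurd rfl h
  | h₂ x hx => intro _; exact ⟨x, 1, by simp, hx.squarefree⟩
  | h₃ x p hx hp ih =>
    intro _
    obtain ⟨a, b, hab, ha⟩ := ih hx
    by_cases hpa : p ∣ a
    · obtain ⟨a', rfl⟩ := hpa
      exact ⟨a', p * b, by rw [hab]; ring, ha.squarefree_of_dvd (Dvd.intro_left _ rfl)⟩
    · refine ⟨p * a, b, by rw [hab]; ring, ?_⟩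
      have hrel : IsRelPrime p a := (hp.irreducible.isRelPrime_iff_not_dvd).2 hpa
      exact (squarefree_mul_iff).2 ⟨hrel, hp.irreducible.squarefree, ha⟩

lemma odd_factor {F : Type*} [Field F] {k : ℕ} (f : MvPolynomial (Fin k) F)
    (hf : ¬ ∃ (c : F) (g : MvPolynomial (Fin k) F), f = MvPolynomial.C c * g ^ 2) :
    ∃ (p h : MvPolynomial (Fin k) F) (m : ℕ), Prime p ∧ f = p ^ (2 * m + 1) * h ∧ ¬ p ∣ h := by
  have hf0 : f ≠ 0 := by rintro rfl; exact hf ⟨0, 0, by simp⟩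
  obtain ⟨a, b, hab, ha⟩ := sqfree_decomp f hf0
  have ha0 : a ≠ 0 := by rintro rfl; simp at hab; exact hf0 hab
  have hb0 : b ≠ 0 := by rintro rfl; simp at hab; exact hf0 hab
  have hau : ¬ IsUnit a := by
    intro hu
    obtain ⟨r, _, rfl⟩ := isUnit_iff_eq_C_of_isReduced.1 hu
    exact hf ⟨r, b, hab⟩
  obtain ⟨p, hpi, a', rfl⟩ := WfDvdMonoid.exists_irreducible_factor hau ha0
  have hp : Prime p := hpi.prime
  obtain ⟨b', hb', hpb⟩ := (FiniteMultiplicity.of_prime_left hp hb0).exists_eq_pow_mul_and_not_dvd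
  refine ⟨p, a' * b' ^ 2, multiplicity p b, hp, ?_, ?_⟩
  · rw [hab]
    conv_lhs => rw [hb']
    ring
  · intro h
    rcases hp.dvd_or_dvd h with h | h
    · exact hp.not_isUnit (ha p (mul_dvd_mul_left p h))
    · exact hpb (hp.dvd_of_dvd_pow h)

lemma vars_dvd {F : Type*} [Field F] {σ : Type*} {p w : MvPolynomial σ F} (hw : w ≠ 0)
    (h : p ∣ w) {i : σ} (hi : i ∈ p.vars) : i ∈ w.vars := by
  obtain ⟨u, rfl⟩ := h
  rw [mem_vars_iff_degreeOf_ne_zero] at *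
  rw [degreeOf_mul_eq (left_ne_zero_of_mul hw) (right_ne_zero_of_mul hw)]
  omega

lemma exists_zero {K : Type*} [Field K] [IsAlgClosed K] {k : ℕ} (p : MvPolynomial (Fin k) K)
    (hp : ¬ IsUnit p) : ∃ x, eval x p = 0 := by
  obtain ⟨M, hM, hpM⟩ := exists_max_ideal_of_mem_nonunits hp
  obtain ⟨x, rfl⟩ := isMaximal_iff_eq_vanishingIdeal_singleton.1 hM
  refine ⟨x, ?_⟩
  have := (mem_vanishingIdeal_singleton_iff _ _).1 hpM
  simpa [aeval_eq_eval] using this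

lemma all_vars {F : Type} [Field F] {k : ℕ} (hk : 2 ≤ k) (f : MvPolynomial (Fin k) F)
    (hs : f.IsSymmetric) (hf : Admissible f) (p : MvPolynomial (Fin k) F) (hp : Prime p)
    (hpf : p ∣ f) (i : Fin k) : i ∈ p.vars := by
  by_contra hi
  let z : Fin k := ⟨0, by omega⟩
  set σ := Equiv.swap i z with hσ
  set p' := rename σ p with hp'
  have hz : z ∉ p'.vars := by
    rw [mem_vars_iff_degreeOf_ne_zero, not_not] at *
    have := degreeOf_rename_of_injective (p := p) σ.injective i
    rw [← hp', hi, hσ, Equiv.swap_apply_left] at this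
    exact this
  have hp'f : p' ∣ f := by
    have := map_dvd (rename σ) hpf
    rwa [hs σ] at this
  have hp'u : Prime p' := (MulEquiv.prime_iff (renameEquiv F σ)).2 hp
  set φ := algebraMap F (AlgebraicClosure F) with hφ
  have hPu : ¬ IsUnit (map φ p') := by
    intro hu
    obtain ⟨r, _, hr⟩ := isUnit_iff_eq_C_of_isReduced.1 hu
    have h1 : p'.vars = ∅ := by
      rw [← vars_map_of_injective p' φ.injective, hr, vars_C]
    obtain ⟨q0, hq0⟩ := exists_rename_eq_of_vars_subset_range p' (Fin.elim0 : Fin 0 → Fin k)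
      (fun a => a.elim0) (by simp [h1])
    rw [eq_C_of_isEmpty q0, rename_C] at hq0
    apply hp'u.not_isUnit
    rw [← hq0]
    apply IsUnit.map
    rw [isUnit_iff_ne_zero]
    intro h0
    rw [h0, map_zero] at hq0
    exact hp'u.ne_zero hq0.symm
  obtain ⟨x, hx⟩ := exists_zero _ hPu
  refine hf.2 (fun j => x ⟨j + 1, by have := j.2; omega⟩) ?_
  obtain ⟨u, hu⟩ := hp'f
  rw [hu, map_mul, substX, map_mul]
  have : (aeval fun i : Fin k => if h : (i : ℕ) = 0 then (Polynomial.X : Polynomial (AlgebraicClosure F))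
      else Polynomial.C (x ⟨(i : ℕ) - 1 + 1, by have := i.isLt; omega⟩)) (map φ p') =
      Polynomial.C (eval x (map φ p')) := by
    have e : Polynomial.C (eval x (map φ p')) = aeval (fun i => Polynomial.C (x i)) (map φ p') := by
      have := MvPolynomial.aeval_algebraMap_apply (A := AlgebraicClosure F) (Polynomial (AlgebraicClosure F)) x (map φ p')
      rw [aeval_eq_eval] at this
      exact this.symm
    rw [e]
    refine eval₂Hom_congr' rfl ?_ rfl
    intro j hj _
    have hjz : (j : ℕ) ≠ 0 := by
      intro h0
      have : j = z := Fin.ext h0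
      rw [this, vars_map_of_injective p' φ.injective] at hj
      exact hz hj
    rw [dif_neg hjz]
    congr 2
    apply Fin.ext
    simp only
    omega
  erw [this]
  rw [hx]
  simp

lemma prime_rename {F : Type} [Field F] {σ τ : Type} (e : σ → τ) (he : Function.Injective e)
    (p : MvPolynomial σ F) (hp : Prime p) : Prime (rename e p) := by
  have h1 : rename e p = rename (Subtype.val : Set.range e → τ)
      (renameEquiv F (Equiv.ofInjective e he) p) := by
    rw [renameEquiv_apply, rename_rename]; rfl
  rw [h1, prime_rename_iff]
  exact (MulEquiv.prime_iff (renameEquiv F (Equiv.ofInjective e he))).2 hp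

lemma not_sq_prod {F : Type} [Field F] {k s : ℕ} (hk : 2 ≤ k) (f : MvPolynomial (Fin k) F)
    (hs : f.IsSymmetric) (hf : Admissible f) (T : Finset (Finset (Fin s)))
    (e : Finset (Fin s) → Fin k → Fin s) (he : ∀ S ∈ T, Function.Injective (e S))
    (heS : ∀ S ∈ T, Finset.image (e S) Finset.univ = S) (S0 : Finset (Fin s)) (hS0 : S0 ∈ T)
    (v : Fin s) (hv : v ∈ S0) (c : MvPolynomial (Fin s) F) (hc : c ≠ 0) (hcv : v ∉ c.vars)
    (B : MvPolynomial (Fin s) F) : c * ∏ S ∈ T, rename (e S) f ≠ B ^ 2 := by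
  intro hB
  have hf0 : f ≠ 0 := by rintro rfl; exact hf.1 ⟨0, 0, by simp⟩
  obtain ⟨p, h, m, hp, hfp, hph⟩ := odd_factor f hf.1
  have hpf : p ∣ f := by rw [hfp]; exact (dvd_pow_self p (by omega)).mul_right _
  have hvars := all_vars hk f hs hf p hp hpf
  set P := rename (e S0) p with hP
  have hPp : Prime P := prime_rename _ (he S0 hS0) p hp
  have hPv : ∀ i ∈ S0, i ∈ P.vars := by
    intro i hi
    rw [← heS S0 hS0] at hi
    obtain ⟨j, _, rfl⟩ := Finset.mem_image.1 hi
    rw [mem_vars_iff_degreeOf_ne_zero, hP, degreeOf_rename_of_injective (he S0 hS0),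
      ← mem_vars_iff_degreeOf_ne_zero]
    exact hvars j
  have hcard : ∀ S ∈ T, S.card = k := by
    intro S hS
    conv_lhs => rw [← heS S hS]
    rw [Finset.card_image_of_injective _ (he S hS), Finset.card_univ, Fintype.card_fin]
  have h1 : ¬ P ∣ c := fun hd => hcv (vars_dvd hc hd (hPv v hv))
  have h2 : ¬ P ∣ rename (e S0) h := by
    intro hd
    have := map_dvd (killCompl (he S0 hS0)) hd
    rw [hP, killCompl_rename_app, killCompl_rename_app] at this
    exact hph this
  have h3 : ¬ P ∣ ∏ S ∈ T.erase S0, rename (e S) f := by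
    intro hd
    obtain ⟨S, hS, hdS⟩ := hPp.exists_mem_finset_dvd hd
    obtain ⟨hne, hST⟩ := Finset.mem_erase.1 hS
    apply hne
    symm
    apply Finset.eq_of_subset_of_card_le
    · intro i hi
      have hne0 : rename (e S) f ≠ 0 := by
        intro h0
        apply hf0
        apply rename_injective _ (he S hST)
        rw [h0, map_zero]
      obtain ⟨j, _, hj⟩ := mem_vars_rename _ _ (vars_dvd hne0 hdS (hPv i hi))
      rw [← heS S hST, ← hj]
      exact Finset.mem_image_of_mem _ (Finset.mem_univ j)
    · rw [hcard S hST, hcard S0 hS0]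
  have h4 : B ^ 2 = P ^ (2 * m + 1) * (c * rename (e S0) h * ∏ S ∈ T.erase S0, rename (e S) f) := by
    rw [← hB, ← Finset.mul_prod_erase T _ hS0]
    conv_lhs => rw [hfp]
    rw [map_mul, map_pow, ← hfp]
    ring
  have h5 := congrArg (emultiplicity P) h4
  rw [emultiplicity_pow hPp, emultiplicity_mul hPp, emultiplicity_mul hPp, emultiplicity_mul hPp,
    emultiplicity_eq_zero.2 h1, emultiplicity_eq_zero.2 h2, emultiplicity_eq_zero.2 h3,
    emultiplicity_pow_self hPp.ne_zero hPp.not_isUnit] at h5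
  simp only [add_zero] at h5
  have h6 : emultiplicity P B ≠ ⊤ := by
    intro ht
    rw [ht] at h5
    simp at h5
    exact absurd h5 (by exact_mod_cast ENat.top_ne_natCast (2 * m + 1))
  obtain ⟨n, hn⟩ := ENat.ne_top_iff_exists.1 h6
  rw [← hn] at h5
  have h7 : 2 * n = 2 * m + 1 := by exact_mod_cast h5
  omega

end Alg


section FinSum

lemma sym_eval {F : Type} [Field F] {k s : ℕ} (f : MvPolynomial (Fin k) F) (hs : f.IsSymmetric)
    (b e : Fin k → Fin s) (hb : Function.Injective b)
    (h : Finset.image e Finset.univ = Finset.image b Finset.univ) (φ : Fin s → F) :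
    eval (fun j => φ (b j)) f = eval φ (rename e f) := by
  have h1 : ∀ i, ∃ j, e j = b i := by
    intro i
    have : b i ∈ Finset.image e Finset.univ := by
      rw [h]; exact Finset.mem_image_of_mem _ (Finset.mem_univ i)
    obtain ⟨j, _, hj⟩ := Finset.mem_image.1 this
    exact ⟨j, hj⟩
  choose σ hσ using h1
  have hinj : Function.Injective σ := by
    intro i j hij
    apply hb
    rw [← hσ, ← hσ, hij]
  let τ : Equiv.Perm (Fin k) := Equiv.ofBijective σ (Finite.injective_iff_bijective.1 hinj)
  rw [eval_rename]
  conv_rhs => rw [← hs τ]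
  rw [eval_rename]
  congr 2
  funext j
  simp [τ, hσ]

lemma main_sum {F : Type} [Field F] [Fintype F] [DecidableEq F] {k s d : ℕ} (hk : 2 ≤ k) (δ : ℝ)
    (f : MvPolynomial (Fin k) F) (hd : f.totalDegree = d)
    (hs : f.IsSymmetric) (hf : Admissible f) (E : Finset (Finset (Fin s)))
    (e : Finset (Fin s) → Fin k → Fin s) (he : ∀ S ∈ E, Function.Injective (e S))
    (heS : ∀ S ∈ E, Finset.image (e S) Finset.univ = S) (η : Finset (Fin s) → ℝ)
    (hη : ∀ S, |η S| ≤ 1)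
    (hb : ∀ G : MvPolynomial (Fin s) F, G.totalDegree ≤ E.card * d → ∀ v : Fin s,
      (∀ c : MvPolynomial (Fin s) F, c ≠ 0 → v ∉ c.vars → ∀ B, c * G ≠ B ^ 2) →
      |∑ φ : Fin s → F, (quadraticChar F (eval φ G) : ℝ)| ≤ δ * (Fintype.card F : ℝ) ^ s)
    (hδ : 0 ≤ δ) :
    |∑ φ : Fin s → F, ∏ S ∈ E, ((1 + η S * (quadraticChar F (eval φ (rename (e S) f)) : ℝ)) / 2) -
      (Fintype.card F : ℝ) ^ s / 2 ^ E.card| ≤ δ * (Fintype.card F : ℝ) ^ s := by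
  set q := (Fintype.card F : ℝ) with hq
  have h1 : ∑ φ : Fin s → F, ∏ S ∈ E, ((1 + η S * (quadraticChar F (eval φ (rename (e S) f)) : ℝ)) / 2)
      = (∑ T ∈ E.powerset, (∏ S ∈ T, η S) * ∑ φ : Fin s → F,
          (quadraticChar F (eval φ (∏ S ∈ T, rename (e S) f)) : ℝ)) / 2 ^ E.card := by
    simp_rw [Finset.mul_sum]
    rw [Finset.sum_comm, Finset.sum_div]
    refine Finset.sum_congr rfl fun φ _ => ?_
    rw [Finset.prod_div_distrib, Finset.prod_const, Finset.prod_one_add]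
    congr 1
    refine Finset.sum_congr rfl fun T _ => ?_
    rw [Finset.prod_mul_distrib, map_prod, map_prod]
    push_cast
    rfl
  have h2 : ∑ T ∈ E.powerset, (∏ S ∈ T, η S) * ∑ φ : Fin s → F,
          (quadraticChar F (eval φ (∏ S ∈ T, rename (e S) f)) : ℝ) =
      q ^ s + ∑ T ∈ E.powerset.erase ∅, (∏ S ∈ T, η S) * ∑ φ : Fin s → F,
          (quadraticChar F (eval φ (∏ S ∈ T, rename (e S) f)) : ℝ) := by
    rw [← Finset.add_sum_erase _ _ (Finset.empty_mem_powerset E)]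
    simp [hq]
  rw [h1, h2, add_div, add_sub_cancel_left, abs_div, abs_of_pos (by positivity : (0 : ℝ) < 2 ^ E.card),
    div_le_iff₀ (by positivity)]
  refine (Finset.abs_sum_le_sum_abs _ _).trans ?_
  refine (Finset.sum_le_card_nsmul _ _ (δ * q ^ s) ?_).trans ?_
  · intro T hT
    obtain ⟨hTne, hTE⟩ := Finset.mem_erase.1 hT
    have hTE := Finset.mem_powerset.1 hTE
    obtain ⟨S0, hS0⟩ := Finset.nonempty_iff_ne_empty.2 hTne
    rw [abs_mul, Finset.abs_prod]
    have a1 : ∏ S ∈ T, |η S| ≤ 1 := Finset.prod_le_one (fun _ _ => abs_nonneg _) (fun S _ => hη S)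
    have hv : e S0 ⟨0, by omega⟩ ∈ S0 := by
      have h := Finset.mem_image_of_mem (e S0) (Finset.mem_univ (⟨0, by omega⟩ : Fin k))
      rwa [heS S0 (hTE hS0)] at h
    have a2 := hb (∏ S ∈ T, rename (e S) f) ?_ (e S0 ⟨0, by omega⟩) ?_
    · calc _ ≤ 1 * |_| := mul_le_mul_of_nonneg_right a1 (abs_nonneg _)
        _ ≤ _ := by rw [one_mul]; exact a2
    · refine (totalDegree_finsetProd _ _).trans ?_
      refine (Finset.sum_le_card_nsmul _ _ d ?_).trans ?_
      · intro S _
        exact (totalDegree_rename_le _ _).trans hd.le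
      · rw [smul_eq_mul]
        exact Nat.mul_le_mul_right _ (Finset.card_le_card hTE)
    · intro c hc hcv B
      exact not_sq_prod hk f hs hf T e (fun S hS => he S (hTE hS)) (fun S hS => heS S (hTE hS)) S0 hS0
        _ hv c hc hcv B
  · rw [nsmul_eq_mul, mul_comm]
    apply mul_le_mul_of_nonneg_left _ (by positivity)
    have : (E.powerset.erase ∅).card ≤ 2 ^ E.card := by
      rw [← Finset.card_powerset]; exact Finset.card_le_card (Finset.erase_subset _ _)
    exact_mod_cast this

end FinSum

theorem stmt_13 (k d s : ℕ) (hk : 2 ≤ k) (hd : 1 ≤ d) (hs : 1 ≤ s)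
    (H : Finset (Finset (Fin s))) (hH : ∀ e ∈ H, e.card = k) :
    ∀ ε : ℝ, 0 < ε → ∃ Q : ℕ, 0 < Q ∧
      ∀ (q : ℕ) (F : Type) [Field F] [Fintype F],
        Fintype.card F = q → Odd q → Q ≤ q →
        ∀ f : MvPolynomial (Fin k) F, f.IsSymmetric → f.totalDegree = d → Admissible f →
          |(Set.ncard {φ : Fin s → F | Function.Injective φ ∧
              ∀ b : Fin k → Fin s, Function.Injective b →
                (Finset.image b Finset.univ ∈ H ↔
                  IsSquare (MvPolynomial.eval (fun j => φ (b j)) f))} : ℝ) -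
            (q : ℝ) ^ s / 2 ^ (s.choose k)| ≤ ε * (q : ℝ) ^ s := by
  classical
  intro ε hε
  set E : Finset (Finset (Fin s)) := Finset.powersetCard k Finset.univ with hE
  have hEc : E.card = s.choose k := by rw [hE, Finset.card_powersetCard]; simp
  obtain ⟨Q1, hQ1⟩ := mv_sum s (E.card * d) (ε / 2) (by positivity)
  set C0 : ℕ := s * s + E.card * d with hC0
  obtain ⟨m, hm⟩ := exists_nat_ge (2 * C0 / ε)
  refine ⟨Q1 + m + 1, by omega, ?_⟩
  intro q F _ _ hq hodd hQ f hsym hfd hadm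
  subst hq
  have hex : ∀ S : Finset (Fin s), ∃ e : Fin k → Fin s, S ∈ E → Function.Injective e ∧
      Finset.image e Finset.univ = S := by
    intro S
    by_cases hS : S ∈ E
    · have hc : S.card = k := (Finset.mem_powersetCard.1 hS).2
      refine ⟨S.orderEmbOfFin hc, fun _ => ⟨(S.orderEmbOfFin hc).injective, ?_⟩⟩
      exact Finset.image_orderEmbOfFin_univ S hc
    · exact ⟨fun _ => ⟨0, hs⟩, fun h => absurd h hS⟩
  choose e he using hex
  set q := Fintype.card F with hq
  let η : Finset (Fin s) → ℝ := fun S => if S ∈ H then 1 else -1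
  have hη : ∀ S, |η S| ≤ 1 := by
    intro S
    simp only [η]
    split_ifs <;> simp
  have hmain := main_sum hk (ε / 2) f hfd hsym hadm E e (fun S hS => (he S hS).1)
    (fun S hS => (he S hS).2) η hη (hQ1 F hodd (by omega)) (by positivity)
  set M : (Fin s → F) → ℝ := fun φ =>
    ∏ S ∈ E, ((1 + η S * (quadraticChar F (eval φ (rename (e S) f)) : ℝ)) / 2) with hM
  set cond : (Fin s → F) → Prop := fun φ => Function.Injective φ ∧
              ∀ b : Fin k → Fin s, Function.Injective b →
                (Finset.image b Finset.univ ∈ H ↔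
                  IsSquare (MvPolynomial.eval (fun j => φ (b j)) f)) with hcond
  set bad : (Fin s → F) → ℝ := fun φ =>
    (∑ i : Fin s, ∑ j : Fin s, if i ≠ j ∧ φ i = φ j then (1 : ℝ) else 0) +
    ∑ S ∈ E, if eval φ (rename (e S) f) = 0 then (1 : ℝ) else 0 with hbad
  have hMb : ∀ φ, 0 ≤ M φ ∧ M φ ≤ 1 := by
    intro φ
    have hx : ∀ S ∈ E, 0 ≤ (1 + η S * (quadraticChar F (eval φ (rename (e S) f)) : ℝ)) / 2 ∧
        (1 + η S * (quadraticChar F (eval φ (rename (e S) f)) : ℝ)) / 2 ≤ 1 := by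
      intro S _
      have h1 : |η S * (quadraticChar F (eval φ (rename (e S) f)) : ℝ)| ≤ 1 := by
        rw [abs_mul]
        exact mul_le_one₀ (hη S) (abs_nonneg _) (abs_qc _)
      rw [abs_le] at h1
      constructor <;> linarith
    exact ⟨Finset.prod_nonneg fun S hS => (hx S hS).1,
      Finset.prod_le_one (fun S hS => (hx S hS).1) fun S hS => (hx S hS).2⟩
  have hbad0 : ∀ φ, 0 ≤ bad φ := by
    intro φ
    simp only [hbad]
    apply add_nonneg
    · exact Finset.sum_nonneg fun i _ => Finset.sum_nonneg fun j _ => by split_ifs <;> norm_num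
    · exact Finset.sum_nonneg fun i _ => by split_ifs <;> norm_num
  have hpt : ∀ φ, |(if cond φ then (1 : ℝ) else 0) - M φ| ≤ bad φ := by
    intro φ
    have htriv : 1 ≤ bad φ → |(if cond φ then (1 : ℝ) else 0) - M φ| ≤ bad φ := by
      intro h1
      refine le_trans ?_ h1
      obtain ⟨a, b⟩ := hMb φ
      rw [abs_le]
      split_ifs <;> constructor <;> linarith
    by_cases hinj : Function.Injective φ
    swap
    · apply htriv
      simp only [Function.Injective] at hinj
      push Not at hinj
      obtain ⟨i, j, hij, hne⟩ := hinj
      have h1 : (1 : ℝ) ≤ ∑ i : Fin s, ∑ j : Fin s, if i ≠ j ∧ φ i = φ j then (1 : ℝ) else 0 := by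
        calc (1 : ℝ) = if i ≠ j ∧ φ i = φ j then (1 : ℝ) else 0 := by rw [if_pos ⟨hne, hij⟩]
          _ ≤ ∑ j : Fin s, if i ≠ j ∧ φ i = φ j then (1 : ℝ) else 0 :=
            Finset.single_le_sum (f := fun j => if i ≠ j ∧ φ i = φ j then (1 : ℝ) else 0)
              (fun j _ => by split_ifs <;> norm_num) (Finset.mem_univ j)
          _ ≤ _ := Finset.single_le_sum
              (f := fun i => ∑ j : Fin s, if i ≠ j ∧ φ i = φ j then (1 : ℝ) else 0)
              (fun i _ => Finset.sum_nonneg fun j _ => by split_ifs <;> norm_num) (Finset.mem_univ i)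
      have h2 : (0 : ℝ) ≤ ∑ S ∈ E, if eval φ (rename (e S) f) = 0 then (1 : ℝ) else 0 :=
        Finset.sum_nonneg fun i _ => by split_ifs <;> norm_num
      simp only [hbad]
      linarith
    by_cases hz : ∃ S ∈ E, eval φ (rename (e S) f) = 0
    · apply htriv
      obtain ⟨S, hS, h0⟩ := hz
      have h1 : (0 : ℝ) ≤ ∑ i : Fin s, ∑ j : Fin s, if i ≠ j ∧ φ i = φ j then (1 : ℝ) else 0 :=
        Finset.sum_nonneg fun i _ => Finset.sum_nonneg fun j _ => by split_ifs <;> norm_num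
      have h2 : (1 : ℝ) ≤ ∑ S ∈ E, if eval φ (rename (e S) f) = 0 then (1 : ℝ) else 0 := by
        calc (1 : ℝ) = if eval φ (rename (e S) f) = 0 then (1 : ℝ) else 0 := by rw [if_pos h0]
          _ ≤ _ := Finset.single_le_sum
            (f := fun S => if eval φ (rename (e S) f) = 0 then (1 : ℝ) else 0)
              (fun j _ => by split_ifs <;> norm_num) hS
      simp only [hbad]
      linarith
    push Not at hz
    have hfac : ∀ S ∈ E, (1 + η S * (quadraticChar F (eval φ (rename (e S) f)) : ℝ)) / 2 =
        if (S ∈ H ↔ IsSquare (eval φ (rename (e S) f))) then 1 else 0 := by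
      intro S hS
      have h0 := hz S hS
      rcases quadraticChar_dichotomy h0 with h | h
      · have hsq := (quadraticChar_one_iff_isSquare h0).1 h
        by_cases hSH : S ∈ H <;> simp [η, h, hsq, hSH]
      · have hsq := quadraticChar_neg_one_iff_not_isSquare.1 h
        by_cases hSH : S ∈ H <;> simp [η, h, hsq, hSH]
    have hMe : M φ = if cond φ then 1 else 0 := by
      simp only [hM]
      rw [Finset.prod_congr rfl hfac]
      split_ifs with hc
      · apply Finset.prod_eq_one
        intro S hS
        rw [if_pos]
        have := hc.2 (e S) (he S hS).1
        rw [(he S hS).2] at this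
        rw [this, eval_rename]
        rfl
      · simp only [hcond] at hc
        push Not at hc
        obtain ⟨b, hb, hbn⟩ := hc hinj
        have hbE : Finset.image b Finset.univ ∈ E := by
          rw [hE, Finset.mem_powersetCard]
          refine ⟨Finset.subset_univ _, ?_⟩
          rw [Finset.card_image_of_injective _ hb, Finset.card_univ, Fintype.card_fin]
        apply Finset.prod_eq_zero hbE
        rw [if_neg]
        rw [← sym_eval f hsym b _ hb (he _ hbE).2 φ]
        tauto
    rw [hMe, sub_self, abs_zero]
    exact hbad0 φ
  have hqpos : (0 : ℝ) < q := by exact_mod_cast Fintype.card_pos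
  have hf0 : f ≠ 0 := by rintro rfl; exact hadm.1 ⟨0, 0, by simp⟩
  have hbadsum : (∑ φ, bad φ) * q ≤ C0 * (q : ℝ) ^ s := by
    simp only [hbad]
    rw [Finset.sum_add_distrib, add_mul]
    have b1 : (∑ φ : Fin s → F, ∑ i : Fin s, ∑ j : Fin s,
        if i ≠ j ∧ φ i = φ j then (1 : ℝ) else 0) * q ≤ (s * s : ℝ) * (q : ℝ) ^ s := by
      rw [Finset.sum_comm, Finset.sum_mul]
      have : ∀ i ∈ (Finset.univ : Finset (Fin s)), (∑ φ : Fin s → F, ∑ j : Fin s,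
          if i ≠ j ∧ φ i = φ j then (1 : ℝ) else 0) * q ≤ (s : ℝ) * (q : ℝ) ^ s := by
        intro i _
        rw [Finset.sum_comm, Finset.sum_mul]
        have : ∀ j ∈ (Finset.univ : Finset (Fin s)), (∑ φ : Fin s → F,
            if i ≠ j ∧ φ i = φ j then (1 : ℝ) else 0) * q ≤ (q : ℝ) ^ s := by
          intro j _
          by_cases hij : i = j
          · simp [hij]
          · have hne : (X i - X j : MvPolynomial (Fin s) F) ≠ 0 := by
              intro h
              exact hij (X_injective (sub_eq_zero.1 h))
            have := sz_bound (K := 1) (X i - X j : MvPolynomial (Fin s) F) hne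
              ((totalDegree_sub _ _).trans (by simp))
            simpa [hij, sub_eq_zero] using this
        refine (Finset.sum_le_card_nsmul _ _ _ this).trans ?_
        simp
      refine (Finset.sum_le_card_nsmul _ _ _ this).trans ?_
      simp [mul_assoc]
    have b2 : (∑ φ : Fin s → F, ∑ S ∈ E, if eval φ (rename (e S) f) = 0 then (1 : ℝ) else 0) * q ≤
        (E.card * d : ℝ) * (q : ℝ) ^ s := by
      rw [Finset.sum_comm, Finset.sum_mul]
      have : ∀ S ∈ E, (∑ φ : Fin s → F, if eval φ (rename (e S) f) = 0 then (1 : ℝ) else 0) * q ≤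
          (d : ℝ) * (q : ℝ) ^ s := by
        intro S hS
        have hne : rename (e S) f ≠ 0 := by
          intro h0
          apply hf0
          apply rename_injective _ (he S hS).1
          rw [h0, map_zero]
        have := sz_bound (K := d) (rename (e S) f) hne ((totalDegree_rename_le _ _).trans hfd.le)
        simpa using this
      refine (Finset.sum_le_card_nsmul _ _ _ this).trans ?_
      simp [mul_assoc]
    rw [hC0]
    push_cast
    linarith
  have hbads : (∑ φ, bad φ) ≤ ε / 2 * (q : ℝ) ^ s := by
    rw [div_le_iff₀ hε] at hm
    have hmq : (m : ℝ) ≤ q := by exact_mod_cast (by omega : m ≤ q)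
    have h4 : (C0 : ℝ) ≤ ε / 2 * q := by nlinarith
    have h5 : (C0 : ℝ) * (q : ℝ) ^ s ≤ ε / 2 * q * q ^ s := by gcongr
    refine le_of_mul_le_mul_right ?_ hqpos
    linarith
  have hcount : (Set.ncard {φ : Fin s → F | cond φ} : ℝ) = ∑ φ : Fin s → F, if cond φ then (1 : ℝ) else 0 := by
    rw [Set.ncard_eq_toFinset_card']
    rw [Finset.sum_boole]
    congr 2
    ext φ
    simp
  have hdiff : |(∑ φ : Fin s → F, if cond φ then (1 : ℝ) else 0) - ∑ φ, M φ| ≤ ε / 2 * (q : ℝ) ^ s := by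
    rw [← Finset.sum_sub_distrib]
    refine (Finset.abs_sum_le_sum_abs _ _).trans ?_
    exact (Finset.sum_le_sum fun φ _ => hpt φ).trans hbads
  rw [hEc] at hmain
  change |(Set.ncard {φ : Fin s → F | cond φ} : ℝ) - _| ≤ _
  rw [hcount]
  rw [abs_le] at hdiff hmain ⊢
  constructor <;> linarith [hdiff.1, hdiff.2, hmain.1, hmain.2]
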